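/- For every k ≥ 1 and u ∈ ℂ, the elementary symmetric function e_k(u) equals the sum, over all compositions λ = (λ_1, …, λ_m) of k (the order of parts matters), of ((−1)^{k−m} / (a_1 a_2 ⋯ a_m)) • p⁻_{λ_1}(u) * p⁻_{λ_2}(u−a_1) * ⋯ * p⁻_{λ_m}(u−a_{m−1}), where a_i := λ_1 + ⋯ + λ_i, a_0 := 0, and the product is taken in the given order in the (noncommutative) algebra A. -/

import Mathlib

/-- Matrices in the `k`-leg model over `A`: square matrices indexed by functions
`Fin k → Fin n`, a model of `End((ℂ^n)^⊗k) ⊗ A`. -/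
abbrev LegMatrix (n k : ℕ) (A : Type*) := Matrix (Fin k → Fin n) (Fin k → Fin n) A

variable {n : ℕ} {A : Type*} [Ring A] [Algebra ℂ A]

/-- `T_s(v)`: the generating matrix `T(v)` placed on leg `s` of the `k`-leg model. -/
def Tleg (T : ℂ → Matrix (Fin n) (Fin n) A) {k : ℕ} (s : Fin k) (v : ℂ) :
    LegMatrix n k A := fun f g =>
  if ∀ t : Fin k, t ≠ s → f t = g t then T v (f s) (g s) else 0

/-- The permutation matrix `P_σ` of a permutation `σ` of the legs:
its `(f,g)`-entry is `1` (via `algebraMap ℂ A`) if `f = g ∘ σ` and `0` otherwise. -/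
def Pleg (n : ℕ) (A : Type*) [Ring A] [Algebra ℂ A] {k : ℕ} (σ : Equiv.Perm (Fin k)) :
    LegMatrix n k A := fun f g => if f = g ∘ σ then algebraMap ℂ A 1 else 0

/-- The transposition of legs with 1-based labels `i`, `j` (identity if out of range;
all uses are in range). -/
def legSwap (k i j : ℕ) : Equiv.Perm (Fin k) :=
  if h : 1 ≤ i ∧ i ≤ k ∧ 1 ≤ j ∧ j ≤ k then
    Equiv.swap ⟨i - 1, by omega⟩ ⟨j - 1, by omega⟩ else 1

/-- The antisymmetrizer `A_k = (1/k!) • Σ_σ sgn(σ) • P_σ` in the `k`-leg model. -/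
noncomputable def Aleg (n : ℕ) (A : Type*) [Ring A] [Algebra ℂ A] (k : ℕ) :
    LegMatrix n k A :=
  ((k.factorial : ℂ))⁻¹ •
    ∑ σ : Equiv.Perm (Fin k), ((Equiv.Perm.sign σ : ℤ) : ℂ) • Pleg n A σ

/-- The symmetrizer `S_k = (1/k!) • Σ_σ P_σ` in the `k`-leg model. -/
noncomputable def Sleg (n : ℕ) (A : Type*) [Ring A] [Algebra ℂ A] (k : ℕ) :
    LegMatrix n k A :=
  ((k.factorial : ℂ))⁻¹ • ∑ σ : Equiv.Perm (Fin k), Pleg n A σ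

/-- The ordered product `T_1(u) * T_2(u+d) * ⋯ * T_k(u+(k−1)d)` in the `k`-leg model. -/
noncomputable def TT (T : ℂ → Matrix (Fin n) (Fin n) A) (k : ℕ) (u d : ℂ) :
    LegMatrix n k A :=
  ((List.finRange k).map (fun s => Tleg T s (u + d * ((s : ℕ) : ℂ)))).prod

/-- The RTT relation of the Yangian of `gl_n`:
`((u−v) • 1 − P_{1,2}) T_1(u) T_2(v) = T_2(v) T_1(u) ((u−v) • 1 − P_{1,2})`
in the 2-leg model. -/
def RTT (T : ℂ → Matrix (Fin n) (Fin n) A) : Prop :=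
  ∀ u v : ℂ,
    ((u - v) • (1 : LegMatrix n 2 A) - Pleg n A (legSwap 2 1 2)) *
        Tleg T (0 : Fin 2) u * Tleg T (1 : Fin 2) v =
      Tleg T (1 : Fin 2) v * Tleg T (0 : Fin 2) u *
        ((u - v) • (1 : LegMatrix n 2 A) - Pleg n A (legSwap 2 1 2))

/-- The elementary symmetric function
`e_k(u) = trace(A_k * T_1(u) * T_2(u−1) * ⋯ * T_k(u−k+1))`; for `k = 0` this is `1`. -/
noncomputable def esym (T : ℂ → Matrix (Fin n) (Fin n) A) (k : ℕ) (u : ℂ) : A :=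
  Matrix.trace (Aleg n A k * TT T k u (-1))

/-- The homogeneous symmetric function
`h_k(u) = trace(S_k * T_1(u) * T_2(u+1) * ⋯ * T_k(u+k−1))`; for `k = 0` this is `1`. -/
noncomputable def hsym (T : ℂ → Matrix (Fin n) (Fin n) A) (k : ℕ) (u : ℂ) : A :=
  Matrix.trace (Sleg n A k * TT T k u 1)

/-- The power sum `p⁻_k(u) = trace(T(u) * T(u−1) * ⋯ * T(u−k+1))`,
an ordinary product of `n×n` matrices over `A`. -/
noncomputable def pminus (T : ℂ → Matrix (Fin n) (Fin n) A) (k : ℕ) (u : ℂ) : A :=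
  Matrix.trace (((List.finRange k).map (fun i => T (u - ((i : ℕ) : ℂ)))).prod)

/-- The power sum `p⁺_k(u) = trace(T(u) * T(u+1) * ⋯ * T(u+k−1))`,
an ordinary product of `n×n` matrices over `A`. -/
noncomputable def pplus (T : ℂ → Matrix (Fin n) (Fin n) A) (k : ℕ) (u : ℂ) : A :=
  Matrix.trace (((List.finRange k).map (fun i => T (u + ((i : ℕ) : ℂ)))).prod)

set_option linter.unusedSectionVars false

open Equiv

/-- The ordered product `T(u)_{a₀ b₀} * T(u-1)_{a₁ b₁} * ⋯` of entries of `T`. -/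
noncomputable def entryProd (T : ℂ → Matrix (Fin n) (Fin n) A) (u : ℂ) {k : ℕ}
    (a b : Fin k → Fin n) : A :=
  (List.ofFn fun s : Fin k => T (u - ((s : ℕ) : ℂ)) (a s) (b s)).prod

/-- The quantum minor of `T` with rows `a` and columns `b`. -/
noncomputable def qminor (T : ℂ → Matrix (Fin n) (Fin n) A) (u : ℂ) {k : ℕ}
    (a b : Fin k → Fin n) : A :=
  ∑ σ : Perm (Fin k), (Perm.sign σ : ℤ) • entryProd T u (a ∘ σ) b

/-- `(m + 1)!` times the trace of `A_{m+1} * T_1(u) * ⋯ * T_m(u-m+1) * M_{m+1}`. -/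
noncomputable def antisymTrace (T : ℂ → Matrix (Fin n) (Fin n) A) (u : ℂ) (m : ℕ)
    (M : Matrix (Fin n) (Fin n) A) : A :=
  ∑ σ : Perm (Fin (m + 1)), (Perm.sign σ : ℤ) • ∑ f : Fin (m + 1) → Fin n,
    entryProd T u (fun s : Fin m => f (σ s.castSucc)) (fun s => f s.castSucc) *
      M (f (σ (Fin.last m))) (f (Fin.last m))

theorem entryProd_succ (T : ℂ → Matrix (Fin n) (Fin n) A) (u : ℂ) {k : ℕ}
    (a b : Fin (k + 1) → Fin n) :
    entryProd T u a b = entryProd T u (fun s : Fin k => a s.castSucc) (fun s => b s.castSucc) *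
      T (u - (k : ℂ)) (a (Fin.last k)) (b (Fin.last k)) := by
  rw [entryProd, List.ofFn_succ', List.concat_eq_append, List.prod_append, List.prod_singleton]
  rfl

theorem prod_map_Tleg (T : ℂ → Matrix (Fin n) (Fin n) A) {k : ℕ} (v : Fin k → ℂ)
    (l : List (Fin k)) (hl : l.Nodup) (f g : Fin k → Fin n) :
    (l.map fun s => Tleg T s (v s)).prod f g =
      if ∀ t, t ∉ l → f t = g t then (l.map fun s => T (v s) (f s) (g s)).prod else 0 := by
  induction l generalizing f with
  | nil => simp [Matrix.one_apply, funext_iff]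
  | cons s l ih =>
    obtain ⟨hs, hl⟩ := List.nodup_cons.1 hl
    rw [List.map_cons, List.prod_cons, Matrix.mul_apply,
      Finset.sum_eq_single (Function.update f s (g s))]
    · rw [ih hl]
      have h1 : (l.map fun t => T (v t) (Function.update f s (g s) t) (g t)) =
          l.map fun t => T (v t) (f t) (g t) := by
        refine List.map_congr_left fun t ht => ?_
        rw [Function.update_of_ne (by rintro rfl; exact hs ht)]
      have h2 : (∀ t, t ∉ l → Function.update f s (g s) t = g t) ↔
          ∀ t, t ∉ s :: l → f t = g t := by
        refine forall_congr' fun t => ?_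
        by_cases h : t = s
        · subst h; simp
        · simp [h]
      have h3 : Tleg T s (v s) f (Function.update f s (g s)) = T (v s) (f s) (g s) := by
        unfold Tleg
        rw [if_pos, Function.update_self]
        intro t ht
        rw [Function.update_of_ne ht]
      rw [h1, h3, List.map_cons, List.prod_cons]
      simp only [h2, mul_ite, mul_zero]
    · intro h _ hne
      rw [ih hl]
      unfold Tleg
      split_ifs with h1 h2
      · refine absurd (funext fun t => ?_) hne
        by_cases ht : t = s
        · subst ht; simp [h2 t hs]
        · rw [Function.update_of_ne ht, h1 t ht]
      all_goals simp
    · simp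

theorem TT_apply (T : ℂ → Matrix (Fin n) (Fin n) A) (k : ℕ) (u : ℂ) (f g : Fin k → Fin n) :
    TT T k u (-1) f g = entryProd T u f g := by
  rw [TT, prod_map_Tleg T (fun s : Fin k => u + -1 * ((s : ℕ) : ℂ)) _ (List.nodup_finRange k),
    if_pos (by simp), entryProd, List.ofFn_eq_map]
  simp [sub_eq_add_neg]

theorem Pleg_mul_apply {k : ℕ} (σ : Perm (Fin k)) (X : LegMatrix n k A) (f g : Fin k → Fin n) :
    (Pleg n A σ * X) f g = X (f ∘ σ.symm) g := by
  rw [Matrix.mul_apply, Finset.sum_eq_single (f ∘ σ.symm)]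
  · simp [Pleg, Function.comp_assoc]
  · intro h _ hne
    have : f ≠ h ∘ σ := by
      rintro rfl
      simp [Function.comp_assoc] at hne
    simp [Pleg, this]
  · simp

theorem factorial_smul_esym (T : ℂ → Matrix (Fin n) (Fin n) A) (k : ℕ) (u : ℂ) :
    (k.factorial : ℂ) • esym T k u = ∑ f : Fin k → Fin n, qminor T u f f := by
  have hk : (k.factorial : ℂ) ≠ 0 := by exact_mod_cast k.factorial_ne_zero
  rw [esym, Aleg, Matrix.smul_mul, Matrix.trace_smul, smul_inv_smul₀ hk, Finset.sum_mul,
    Matrix.trace_sum]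
  simp only [qminor]
  rw [Finset.sum_comm, ← Equiv.sum_comp (Equiv.inv (Perm (Fin k)))]
  refine Finset.sum_congr rfl fun σ _ => ?_
  rw [Matrix.smul_mul, Matrix.trace_smul, ← Finset.smul_sum]
  simp only [Matrix.trace, Matrix.diag_apply, Pleg_mul_apply, TT_apply, Equiv.inv_apply,
    Perm.sign_inv, Int.cast_smul_eq_zsmul]
  rfl

theorem antisymTrace_self (T : ℂ → Matrix (Fin n) (Fin n) A) (m : ℕ) (u : ℂ) :
    antisymTrace T u m (T (u - (m : ℂ))) = ((m + 1).factorial : ℂ) • esym T (m + 1) u := by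
  rw [factorial_smul_esym]
  simp only [qminor]
  rw [Finset.sum_comm]
  refine Finset.sum_congr rfl fun σ _ => ?_
  simp only [← Finset.smul_sum, entryProd_succ, Function.comp_apply]

theorem prod_ofFn_alternating {B : Type*} [Ring B] {m : ℕ} (i : Fin m)
    (w₁ w₂ w₃ w₄ : Fin (m + 1) → B)
    (h₂ : ∀ s, s ≠ i.castSucc → s ≠ i.succ → w₂ s = w₁ s)
    (h₃ : ∀ s, s ≠ i.castSucc → s ≠ i.succ → w₃ s = w₁ s)
    (h₄ : ∀ s, s ≠ i.castSucc → s ≠ i.succ → w₄ s = w₁ s)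
    (h : w₁ i.castSucc * w₁ i.succ - w₂ i.castSucc * w₂ i.succ +
      w₃ i.castSucc * w₃ i.succ - w₄ i.castSucc * w₄ i.succ = 0) :
    (List.ofFn w₁).prod - (List.ofFn w₂).prod + (List.ofFn w₃).prod - (List.ofFn w₄).prod = 0 := by
  induction m with
  | zero => exact i.elim0
  | succ m ih =>
    induction i using Fin.cases with
    | zero =>
      have key : ∀ w : Fin (m + 2) → B, (∀ s, s ≠ (0 : Fin (m + 1)).castSucc →
          s ≠ (0 : Fin (m + 1)).succ → w s = w₁ s) → (List.ofFn w).prod =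
          (w (0 : Fin (m + 1)).castSucc * w (0 : Fin (m + 1)).succ) *
            (List.ofFn fun s : Fin m => w₁ s.succ.succ).prod := by
        intro w hw
        rw [List.ofFn_succ, List.prod_cons, List.ofFn_succ, List.prod_cons, ← mul_assoc]
        congr 3
        funext s
        exact hw _ (by simp [Fin.ext_iff]) (by simp [Fin.ext_iff])
      rw [key w₁ (fun _ _ _ => rfl), key w₂ h₂, key w₃ h₃, key w₄ h₄, ← sub_mul, ← add_mul,
        ← sub_mul, h, zero_mul]
    | succ i =>
      have key : ∀ w : Fin (m + 2) → B, (∀ s, s ≠ i.succ.castSucc →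
          s ≠ i.succ.succ → w s = w₁ s) → (List.ofFn w).prod =
          w₁ 0 * (List.ofFn fun s => w s.succ).prod := by
        intro w hw
        rw [List.ofFn_succ, List.prod_cons, hw 0 (by simp [Fin.ext_iff]) (by simp [Fin.ext_iff])]
      have off : ∀ w : Fin (m + 2) → B, (∀ s, s ≠ i.succ.castSucc →
          s ≠ i.succ.succ → w s = w₁ s) → ∀ s : Fin (m + 1), s ≠ i.castSucc → s ≠ i.succ →
            w s.succ = w₁ s.succ := fun w hw s h1 h2 =>
        hw _ (by simpa [Fin.ext_iff] using h1) (by simpa [Fin.ext_iff] using h2)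
      rw [key w₁ (fun _ _ _ => rfl), key w₂ h₂, key w₃ h₃, key w₄ h₄, ← mul_sub, ← mul_add,
        ← mul_sub, ih i _ _ _ _ (off w₂ h₂) (off w₃ h₃) (off w₄ h₄) h, mul_zero]

theorem RTT.alternating {T : ℂ → Matrix (Fin n) (Fin n) A} (hT : RTT T) (v : ℂ)
    (i j k l : Fin n) :
    T v i j * T (v - 1) k l - T v k j * T (v - 1) i l +
      T v i l * T (v - 1) k j - T v k l * T (v - 1) i j = 0 := by
  have TT2 : ∀ (x y : ℂ) (f g : Fin 2 → Fin n),
      (Tleg T (0 : Fin 2) x * Tleg T (1 : Fin 2) y) f g = T x (f 0) (g 0) * T y (f 1) (g 1) := by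
    intro x y f g
    simpa using prod_map_Tleg T ![x, y] [0, 1] (by simp) f g
  have TT2' : ∀ (x y : ℂ) (f g : Fin 2 → Fin n),
      (Tleg T (1 : Fin 2) y * Tleg T (0 : Fin 2) x) f g = T y (f 1) (g 1) * T x (f 0) (g 0) := by
    intro x y f g
    have := prod_map_Tleg T ![x, y] [1, 0] (by simp) f g
    rw [if_pos (by intro t; fin_cases t <;> simp)] at this
    simpa using this
  have hmulP : ∀ (X : LegMatrix n 2 A) (f g : Fin 2 → Fin n),
      (X * Pleg n A (legSwap 2 1 2)) f g = X f (g ∘ swap 0 1) := by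
    intro X f g
    rw [Matrix.mul_apply, Finset.sum_eq_single (g ∘ swap 0 1)]
    · simp [Pleg, legSwap]
    · intro h _ hne
      simp [Pleg, legSwap, hne]
    · simp
  have hPmul : ∀ (X : LegMatrix n 2 A) (f g : Fin 2 → Fin n),
      (Pleg n A (legSwap 2 1 2) * X) f g = X (f ∘ swap 0 1) g := by
    intro X f g
    rw [Pleg_mul_apply]
    simp [legSwap]
  have key : ∀ p q, T v i p * T (v - 1) k q - T v k p * T (v - 1) i q =
      T (v - 1) k q * T v i p - T (v - 1) k p * T v i q := by
    intro p q
    have h := congrFun (congrFun (hT v (v - 1)) ![i, k]) ![p, q]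
    rw [mul_assoc] at h
    simpa [sub_mul, mul_sub, TT2, TT2', hmulP, hPmul] using h
  have h1 := key j l
  have h2 := key l j
  rw [h1, add_sub_assoc, h2]
  abel

theorem entryProd_alternating {T : ℂ → Matrix (Fin n) (Fin n) A} (hT : RTT T) (u : ℂ) {m : ℕ}
    (i : Fin m) (a b : Fin (m + 1) → Fin n) :
    entryProd T u a b - entryProd T u (a ∘ swap i.castSucc i.succ) b +
      entryProd T u a (b ∘ swap i.castSucc i.succ) -
      entryProd T u (a ∘ swap i.castSucc i.succ) (b ∘ swap i.castSucc i.succ) = 0 := by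
  refine prod_ofFn_alternating i _ _ _ _ ?_ ?_ ?_ ?_
  · intro s h1 h2
    simp [swap_apply_of_ne_of_ne h1 h2]
  · intro s h1 h2
    simp [swap_apply_of_ne_of_ne h1 h2]
  · intro s h1 h2
    simp [swap_apply_of_ne_of_ne h1 h2]
  · have := hT.alternating (u - (i : ℕ)) (a i.castSucc) (b i.castSucc) (a i.succ) (b i.succ)
    simpa [sub_sub] using this

theorem qminor_comp_left (T : ℂ → Matrix (Fin n) (Fin n) A) (u : ℂ) {k : ℕ}
    (τ : Perm (Fin k)) (a b : Fin k → Fin n) :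
    qminor T u (a ∘ τ) b = (Perm.sign τ : ℤ) • qminor T u a b := by
  rw [qminor, qminor, Finset.smul_sum]
  conv_rhs => rw [← Equiv.sum_comp (Equiv.mulLeft τ)]
  refine Finset.sum_congr rfl fun σ _ => ?_
  rw [smul_smul, Equiv.coe_mulLeft, Perm.sign_mul, Units.val_mul, ← mul_assoc, ← Units.val_mul,
    Int.units_mul_self, Units.val_one, one_mul]
  rfl

/-- The RTT relation makes quantum minors alternating in their columns. -/
theorem qminor_comp_swap_right {T : ℂ → Matrix (Fin n) (Fin n) A} (hT : RTT T) (u : ℂ) {m : ℕ}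
    (i : Fin m) (a b : Fin (m + 1) → Fin n) :
    qminor T u a (b ∘ swap i.castSucc i.succ) = -qminor T u a b := by
  have hne : i.castSucc ≠ i.succ := by simp [Fin.ext_iff]
  have hdouble : ∀ c : Fin (m + 1) → Fin n, (2 : ℂ) • qminor T u a c =
      ∑ σ : Perm (Fin (m + 1)), (Perm.sign σ : ℤ) • (entryProd T u (a ∘ σ) c -
        entryProd T u ((a ∘ σ) ∘ swap i.castSucc i.succ) c) := by
    intro c
    have : qminor T u a c = ∑ σ : Perm (Fin (m + 1)),
        -((Perm.sign σ : ℤ) • entryProd T u ((a ∘ σ) ∘ swap i.castSucc i.succ) c) := by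
      rw [qminor, ← Equiv.sum_comp (Equiv.mulRight (swap i.castSucc i.succ))]
      refine Finset.sum_congr rfl fun σ _ => ?_
      simp [Perm.sign_mul, Perm.sign_swap hne, Function.comp_assoc]
    simp only [smul_sub, Finset.sum_sub_distrib]
    rw [two_smul, sub_eq_add_neg, ← Finset.sum_neg_distrib, ← this, ← qminor]
  have h2 : (2 : ℂ) • (qminor T u a (b ∘ swap i.castSucc i.succ) + qminor T u a b) = 0 := by
    rw [smul_add, hdouble, hdouble, ← Finset.sum_add_distrib]
    refine Finset.sum_eq_zero fun σ _ => ?_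
    rw [← smul_add]
    have h := entryProd_alternating hT u i (a ∘ σ) b
    rw [add_sub_assoc, add_comm] at h
    rw [h, smul_zero]
  exact eq_neg_of_add_eq_zero_left ((smul_eq_zero_iff_right two_ne_zero).1 h2)

theorem qminor_comp_right {T : ℂ → Matrix (Fin n) (Fin n) A} (hT : RTT T) (u : ℂ) {m : ℕ}
    (τ : Perm (Fin (m + 1))) (a b : Fin (m + 1) → Fin n) :
    qminor T u a (b ∘ τ) = (Perm.sign τ : ℤ) • qminor T u a b := by
  have hτ : τ ∈ Submonoid.closure (Set.range fun i : Fin m => swap i.castSucc i.succ) := by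
    rw [Perm.mclosure_swap_castSucc_succ]
    trivial
  induction hτ using Submonoid.closure_induction generalizing b with
  | mem x hx =>
    obtain ⟨i, rfl⟩ := hx
    simp only
    rw [qminor_comp_swap_right hT, Perm.sign_swap (by simp [Fin.ext_iff])]
    simp
  | one => simp
  | mul x y _ _ hx hy =>
    rw [Perm.coe_mul, ← Function.comp_assoc, hy, hx, smul_smul, Perm.sign_mul, Units.val_mul,
      mul_comm]

theorem qminor_comp_comp {T : ℂ → Matrix (Fin n) (Fin n) A} (hT : RTT T) (u : ℂ) {m : ℕ}
    (τ : Perm (Fin (m + 1))) (a b : Fin (m + 1) → Fin n) :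
    qminor T u (a ∘ τ) (b ∘ τ) = qminor T u a b := by
  rw [qminor_comp_left, qminor_comp_right hT, smul_smul, ← Units.val_mul, Int.units_mul_self,
    Units.val_one, one_smul]

/-- The extension of a permutation of `Fin m` to `Fin (m + 1)` fixing the last element. -/
def permSnoc {m : ℕ} (e : Perm (Fin m)) : Perm (Fin (m + 1)) :=
  finSuccEquivLast.symm.permCongr (optionCongr e)

theorem permSnoc_castSucc {m : ℕ} (e : Perm (Fin m)) (s : Fin m) :
    permSnoc e s.castSucc = (e s).castSucc := by
  simp [permSnoc, Equiv.permCongr_apply]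

theorem permSnoc_last {m : ℕ} (e : Perm (Fin m)) : permSnoc e (Fin.last m) = Fin.last m := by
  simp [permSnoc, Equiv.permCongr_apply]

theorem sign_permSnoc {m : ℕ} (e : Perm (Fin m)) : Perm.sign (permSnoc e) = Perm.sign e := by
  simp [permSnoc]

theorem sum_perm_fin_succ {B : Type*} [AddCommMonoid B] {m : ℕ} (φ : Perm (Fin (m + 1)) → B) :
    ∑ σ, φ σ = ∑ e : Perm (Fin m), φ (permSnoc e) +
      ∑ j : Fin m, ∑ e : Perm (Fin m), φ (swap (Fin.last m) j.castSucc * permSnoc e) := by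
  rw [← Equiv.sum_comp finSuccEquivLast.symm.permCongr,
    ← Equiv.sum_comp Perm.decomposeOption.symm, Fintype.sum_prod_type, Fintype.sum_option]
  congr 1
  · refine Finset.sum_congr rfl fun e _ => congrArg φ ?_
    rw [Perm.decomposeOption_symm_apply, permSnoc, swap_self]
    rfl
  · refine Finset.sum_congr rfl fun j _ => Finset.sum_congr rfl fun e _ => congrArg φ ?_
    rw [Perm.decomposeOption_symm_apply, permSnoc]
    ext x
    simp only [Equiv.permCongr_apply, Perm.mul_apply, Equiv.symm_symm]
    rw [finSuccEquivLast.symm.injective.map_swap]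
    simp

theorem sum_pi_fin_succ {B : Type*} [AddCommMonoid B] {m : ℕ} (φ : (Fin (m + 1) → Fin n) → B) :
    ∑ f, φ f = ∑ a : Fin m → Fin n, ∑ x : Fin n, φ (Fin.snoc a x : Fin (m + 1) → Fin n) := by
  rw [← Equiv.sum_comp (Fin.snocEquiv fun _ => Fin n), Fintype.sum_prod_type, Finset.sum_comm]
  rfl

theorem antisymTrace_eq_sum_qminor (T : ℂ → Matrix (Fin n) (Fin n) A) (u : ℂ) (m : ℕ)
    (M : Matrix (Fin n) (Fin n) A) :
    antisymTrace T u m M = (∑ f : Fin m → Fin n, qminor T u f f) * M.trace -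
      ∑ j : Fin m, ∑ a : Fin m → Fin n, ∑ x : Fin n,
        qminor T u (Function.update a j x) a * M (a j) x := by
  rw [antisymTrace, sum_perm_fin_succ, sub_eq_add_neg, ← Finset.sum_neg_distrib]
  congr 1
  · simp only [sign_permSnoc, permSnoc_castSucc, permSnoc_last, sum_pi_fin_succ, Fin.snoc_castSucc,
      Fin.snoc_last, ← Finset.mul_sum]
    simp only [qminor, Finset.sum_mul, smul_mul_assoc, Finset.smul_sum]
    rw [Finset.sum_comm]
    rfl
  · refine Finset.sum_congr rfl fun j _ => ?_
    have hsnoc : ∀ (a : Fin m → Fin n) (x : Fin n) (t : Fin m),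
        (Fin.snoc a x : Fin (m + 1) → Fin n) (swap (Fin.last m) j.castSucc t.castSucc) =
          Function.update a j x t := by
      intro a x t
      by_cases h : t = j
      · subst h
        simp
      · rw [swap_apply_of_ne_of_ne (by simp [Fin.ext_iff, t.2.ne]) (by simpa using h),
          Fin.snoc_castSucc, Function.update_of_ne h]
    have hne : Fin.last m ≠ j.castSucc := (Fin.castSucc_lt_last j).ne'
    simp only [Perm.sign_mul, Perm.sign_swap hne, sign_permSnoc, Perm.mul_apply, permSnoc_castSucc,
      permSnoc_last, sum_pi_fin_succ, Fin.snoc_castSucc, Fin.snoc_last, hsnoc, swap_apply_left]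
    simp only [qminor, Finset.sum_mul, smul_mul_assoc, Finset.smul_sum, ← Finset.sum_neg_distrib]
    rw [Finset.sum_comm]
    refine Finset.sum_congr rfl fun a _ => ?_
    rw [Finset.sum_comm]
    refine Finset.sum_congr rfl fun x _ => Finset.sum_congr rfl fun e _ => ?_
    simp [Function.comp_def]

theorem antisymTrace_zero (T : ℂ → Matrix (Fin n) (Fin n) A) (u : ℂ)
    (M : Matrix (Fin n) (Fin n) A) :
    antisymTrace T u 0 M = esym T 0 u * M.trace := by
  rw [antisymTrace_eq_sum_qminor, ← factorial_smul_esym]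
  simp

theorem sum_qminor_update_last (T : ℂ → Matrix (Fin n) (Fin n) A) (u : ℂ) (m : ℕ)
    (M : Matrix (Fin n) (Fin n) A) :
    ∑ a : Fin (m + 1) → Fin n, ∑ x : Fin n,
      qminor T u (Function.update a (Fin.last m) x) a * M (a (Fin.last m)) x =
    antisymTrace T u m (T (u - (m : ℂ)) * M) := by
  simp only [antisymTrace, sum_pi_fin_succ, Fin.update_snoc_last, Fin.snoc_last, Fin.snoc_castSucc,
    qminor, entryProd_succ, Matrix.mul_apply, Function.comp_apply, Finset.mul_sum,
    Finset.smul_sum, Finset.sum_mul, smul_mul_assoc, mul_assoc]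
  conv_rhs => rw [Finset.sum_comm]
  refine Finset.sum_congr rfl fun a _ => ?_
  conv_rhs => rw [Finset.sum_comm]
  rw [Finset.sum_comm]
  refine Finset.sum_congr rfl fun x _ => ?_
  rw [Finset.sum_comm]

theorem antisymTrace_succ {T : ℂ → Matrix (Fin n) (Fin n) A} (hT : RTT T) (u : ℂ) (m : ℕ)
    (M : Matrix (Fin n) (Fin n) A) :
    antisymTrace T u (m + 1) M = ((m + 1).factorial : ℂ) • (esym T (m + 1) u * M.trace) -
      ((m + 1 : ℕ) : ℂ) • antisymTrace T u m (T (u - (m : ℂ)) * M) := by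
  rw [antisymTrace_eq_sum_qminor, ← factorial_smul_esym, smul_mul_assoc]
  congr 1
  rw [← sum_qminor_update_last, Nat.cast_smul_eq_nsmul]
  have h : ∀ j : Fin (m + 1), ∑ a : Fin (m + 1) → Fin n, ∑ x : Fin n,
      qminor T u (Function.update a j x) a * M (a j) x =
      ∑ a : Fin (m + 1) → Fin n, ∑ x : Fin n,
        qminor T u (Function.update a (Fin.last m) x) a * M (a (Fin.last m)) x := by
    intro j
    rw [← Equiv.sum_comp ((swap j (Fin.last m)).arrowCongr (Equiv.refl (Fin n)))]
    refine Finset.sum_congr rfl fun a _ => Finset.sum_congr rfl fun x _ => ?_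
    have ha : ((swap j (Fin.last m)).arrowCongr (Equiv.refl (Fin n))) a =
        a ∘ swap j (Fin.last m) := by
      ext t
      simp [Equiv.arrowCongr]
    have hup : Function.update (a ∘ swap j (Fin.last m)) j x =
        Function.update a (Fin.last m) x ∘ swap j (Fin.last m) := by
      rw [Function.update_comp_equiv]
      simp
    rw [ha, hup, qminor_comp_comp hT]
    simp
  simp only [h, Finset.sum_const, Finset.card_univ, Fintype.card_fin]

theorem pminus_eq_trace_prod_range (T : ℂ → Matrix (Fin n) (Fin n) A) (k : ℕ) (u : ℂ) :
    pminus T k u = (((List.range k).map fun i : ℕ => T (u - (i : ℂ))).prod).trace := by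
  rw [pminus, ← List.map_coe_finRange_eq_range]
  simp [List.map_eq_flatMap]

theorem antisymTrace_eq_sum_esym {T : ℂ → Matrix (Fin n) (Fin n) A} (hT : RTT T) (u : ℂ) (m : ℕ)
    (M : Matrix (Fin n) (Fin n) A) :
    antisymTrace T u m M = (m.factorial : ℂ) • ∑ i ∈ Finset.range (m + 1),
      ((-1 : ℂ) ^ (m - i)) • (esym T i u * (((List.range (m - i)).map fun s : ℕ =>
        T (u - (i : ℂ) - (s : ℂ))).prod * M).trace) := by
  induction m generalizing M with
  | zero => simp [antisymTrace_zero]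
  | succ m ih =>
    rw [antisymTrace_succ hT, ih, Finset.sum_range_succ _ (m + 1), smul_add, smul_smul,
      sub_eq_neg_add]
    congr 1
    rotate_left
    · simp
    · rw [← Nat.cast_mul, ← Nat.factorial_succ, ← smul_neg,
        ← Finset.sum_neg_distrib]
      congr 1
      refine Finset.sum_congr rfl fun i hi => ?_
      have hi : i ≤ m := Nat.lt_succ_iff.1 (Finset.mem_range.1 hi)
      have hc : u - (i : ℂ) - ((m - i : ℕ) : ℂ) = u - (m : ℂ) := by
        rw [Nat.cast_sub hi]
        ring
      rw [Nat.succ_sub hi, List.range_succ, List.map_append, List.prod_append, List.map_singleton,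
        List.prod_singleton, hc, mul_assoc, pow_succ, mul_neg_one, neg_smul]

/-- Newton's identity relating `e_k` and `p⁻_k`. -/
theorem succ_smul_esym_succ {T : ℂ → Matrix (Fin n) (Fin n) A} (hT : RTT T) (u : ℂ) (m : ℕ) :
    ((m + 1 : ℕ) : ℂ) • esym T (m + 1) u = ∑ i ∈ Finset.range (m + 1),
      ((-1 : ℂ) ^ (m - i)) • (esym T i u * pminus T (m + 1 - i) (u - (i : ℂ))) := by
  have hm : (m.factorial : ℂ) ≠ 0 := by exact_mod_cast m.factorial_ne_zero
  apply (smul_right_injective A hm)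
  simp only
  rw [smul_smul, mul_comm, ← Nat.cast_mul, ← Nat.factorial_succ, ← antisymTrace_self,
    antisymTrace_eq_sum_esym hT]
  congr 1
  refine Finset.sum_congr rfl fun i hi => ?_
  have hi : i ≤ m := Nat.lt_succ_iff.1 (Finset.mem_range.1 hi)
  have hc : u - (i : ℂ) - ((m - i : ℕ) : ℂ) = u - (m : ℂ) := by
    rw [Nat.cast_sub hi]
    ring
  rw [pminus_eq_trace_prod_range, Nat.succ_sub hi, List.range_succ, List.map_append,
    List.prod_append, List.map_singleton, List.prod_singleton, hc]

/-- The summand attached to a composition with list of blocks `L`. -/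
noncomputable def compositionTerm (T : ℂ → Matrix (Fin n) (Fin n) A) (u : ℂ) (L : List ℕ) : A :=
  (((-1 : ℂ) ^ (L.sum - L.length)) /
      ∏ i ∈ Finset.range L.length, (((L.take (i + 1)).sum : ℕ) : ℂ)) •
    ((List.range L.length).map fun i : ℕ =>
      pminus T (L.getD i 0) (u - (((L.take i).sum : ℕ) : ℂ))).prod

theorem compositionTerm_append (T : ℂ → Matrix (Fin n) (Fin n) A) (u : ℂ) (L : List ℕ) (l : ℕ)
    (hL : L.length ≤ L.sum) :
    compositionTerm T u (L ++ [l + 1]) = (((-1 : ℂ) ^ l) / ((L.sum + (l + 1) : ℕ) : ℂ)) •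
      (compositionTerm T u L * pminus T (l + 1) (u - (L.sum : ℂ))) := by
  have hprod : ∏ i ∈ Finset.range L.length, ((((L ++ [l + 1]).take (i + 1)).sum : ℕ) : ℂ) =
      ∏ i ∈ Finset.range L.length, (((L.take (i + 1)).sum : ℕ) : ℂ) := by
    refine Finset.prod_congr rfl fun i hi => ?_
    rw [List.take_append_of_le_length (Finset.mem_range.1 hi)]
  have hlist : ((List.range L.length).map fun i : ℕ =>
      pminus T ((L ++ [l + 1]).getD i 0) (u - ((((L ++ [l + 1]).take i).sum : ℕ) : ℂ))) =
      (List.range L.length).map fun i : ℕ =>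
        pminus T (L.getD i 0) (u - (((L.take i).sum : ℕ) : ℂ)) := by
    refine List.map_congr_left fun i hi => ?_
    have hi := List.mem_range.1 hi
    rw [List.take_append_of_le_length hi.le, List.getD_append _ _ _ _ hi]
  have hexp : L.sum + (l + 1) - (L.length + 1) = l + (L.sum - L.length) := by omega
  simp only [compositionTerm, List.length_append, List.length_singleton, List.sum_append,
    List.sum_singleton, List.range_succ, Finset.prod_range_succ, List.map_append, List.prod_append,
    hprod, hlist, hexp, smul_mul_assoc, smul_smul, List.map_singleton, List.prod_singleton]
  rw [List.take_of_length_le (by simp), List.take_append_of_le_length le_rfl, List.take_length,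
    List.getD_append_right _ _ _ _ le_rfl]
  simp only [List.sum_append, List.sum_singleton, Nat.sub_self, List.getD_cons_zero]
  congr 1
  rw [pow_add, div_mul_div_comm, mul_comm (∏ i ∈ _, _)]

theorem sum_composition_succ {B : Type*} [AddCommMonoid B] (m : ℕ) (φ : List ℕ → B) :
    ∑ c : Composition (m + 1), φ c.blocks =
      ∑ i ∈ Finset.range (m + 1), ∑ c : Composition i, φ (c.blocks ++ [m + 1 - i]) := by
  rw [Finset.sum_sigma']
  symm
  refine Finset.sum_bij (fun x hx => ⟨x.2.blocks ++ [m + 1 - x.1], ?_, ?_⟩) ?_ ?_ ?_ ?_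
  · have hx := Finset.mem_range.1 (Finset.mem_sigma.1 hx).1
    intro i hi
    rcases List.mem_append.1 hi with hi | hi
    · exact x.2.blocks_pos hi
    · rw [List.mem_singleton.1 hi]
      omega
  · have hx := Finset.mem_range.1 (Finset.mem_sigma.1 hx).1
    rw [List.sum_append, x.2.blocks_sum, List.sum_singleton]
    omega
  · simp
  · rintro ⟨i, c⟩ _ ⟨j, d⟩ _ h
    obtain ⟨hcd, -⟩ := List.append_inj' (congrArg Composition.blocks h) rfl
    obtain rfl : i = j := by rw [← c.blocks_sum, ← d.blocks_sum, hcd]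
    exact congrArg (Sigma.mk i) (Composition.ext hcd)
  · intro c _
    have hne : c.blocks ≠ [] := by
      intro h
      have := c.blocks_sum
      simp [h] at this
    have hsplit := List.dropLast_append_getLast hne
    have hsum : c.blocks.dropLast.sum + c.blocks.getLast hne = m + 1 := by
      have := congrArg List.sum hsplit
      rwa [List.sum_append, List.sum_singleton, c.blocks_sum] at this
    have hpos : 0 < c.blocks.getLast hne := c.blocks_pos (List.getLast_mem hne)
    refine ⟨⟨c.blocks.dropLast.sum, ⟨c.blocks.dropLast,
      fun hi => c.blocks_pos (List.mem_of_mem_dropLast hi), rfl⟩⟩, ?_, ?_⟩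
    · simp only [Finset.mem_sigma, Finset.mem_range, Finset.mem_univ, and_true]
      omega
    · refine Composition.ext ?_
      change c.blocks.dropLast ++ [m + 1 - c.blocks.dropLast.sum] = c.blocks
      rw [Nat.sub_eq_of_eq_add' hsum.symm, hsplit]
  · intros
    rfl

theorem esym_eq_sum_compositionTerm {T : ℂ → Matrix (Fin n) (Fin n) A} (hT : RTT T) (k : ℕ)
    (u : ℂ) : esym T k u = ∑ c : Composition k, compositionTerm T u c.blocks := by
  induction k using Nat.strong_induction_on with
  | _ k ih =>
    cases k with
    | zero =>
      have hb : ∀ c : Composition 0, c.blocks = [] := fun c => c.blocks_eq_nil.2 rfl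
      simp [hb, composition_card, compositionTerm, esym, Aleg, TT, Pleg, Matrix.trace]
    | succ m =>
      have hm : ((m + 1 : ℕ) : ℂ) ≠ 0 := Nat.cast_ne_zero.2 m.succ_ne_zero
      apply smul_right_injective A hm
      simp only
      rw [succ_smul_esym_succ hT, sum_composition_succ, Finset.smul_sum]
      refine Finset.sum_congr rfl fun i hi => ?_
      have hi' : i < m + 1 := Finset.mem_range.1 hi
      rw [ih i hi', Finset.sum_mul, Finset.smul_sum, Finset.smul_sum]
      refine Finset.sum_congr rfl fun c _ => ?_
      have hl : m + 1 - i = m - i + 1 := by omega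
      have hs : i + (m - i + 1) = m + 1 := by omega
      have hc : c.blocks.length ≤ c.blocks.sum := by
        rw [c.blocks_sum]
        exact c.length_le
      rw [hl, compositionTerm_append _ _ _ _ hc, c.blocks_sum, hs, smul_smul,
        mul_div_cancel₀ _ hm]

/-- `e_k(u)` as a sum over all compositions `λ = (λ_1,…,λ_m)` of `k` of
`((−1)^{k−m}/(a_1⋯a_m)) • p⁻_{λ_1}(u) * p⁻_{λ_2}(u−a_1) * ⋯ * p⁻_{λ_m}(u−a_{m−1})`,
where `a_i = λ_1 + ⋯ + λ_i`. -/
theorem esym_eq_sum_compositions (hn : 1 ≤ n) (T : ℂ → Matrix (Fin n) (Fin n) A)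
    (hT : RTT T) (k : ℕ) (hk : 1 ≤ k) (u : ℂ) :
    esym T k u =
      ∑ c : Composition k,
        (((-1 : ℂ) ^ (k - c.length)) /
            ∏ i ∈ Finset.range c.length, ((c.sizeUpTo (i + 1) : ℕ) : ℂ)) •
          ((List.finRange c.length).map (fun i : Fin c.length =>
            pminus T (c.blocksFun i) (u - ((c.sizeUpTo (i : ℕ) : ℕ) : ℂ)))).prod := by
  rw [esym_eq_sum_compositionTerm hT]
  refine Finset.sum_congr rfl fun c _ => ?_
  rw [compositionTerm, c.blocks_sum, ← List.map_coe_finRange_eq_range, List.map_map]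
  congr 3
  funext i
  simp [Composition.blocksFun, Composition.sizeUpTo]
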